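/- Let r > 0, β ∈ ℝ, 1 ≤ s < ∞, and n ∈ ℕ. The best orthogonal trigonometric approximation of width 2n of the Weyl–Nagy class W^r_{β,∞} in L_s satisfies e^⊥_{2n}(W^r_{β,∞})_s ≥ C n^{−r} for some constant C > 0 independent of n. -/

import Mathlib

open MeasureTheory Real Complex Finset
open scoped ENNReal

/-- The `k`-th Fourier coefficient of a `2π`-periodic function. -/
noncomputable def fourierCoef (f : ℝ → ℂ) (k : ℤ) : ℂ :=
  (1 / (2 * π)) * ∫ t in (-π)..π, f t * Complex.exp (-Complex.I * k * t)

/-- Membership in the Weyl–Nagy class `W^r_{β,∞}`: `f` is `2π`-periodic, integrable,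
and there is a `2π`-periodic integrable `g = f^r_β` with `‖g‖_∞ ≤ 1` whose Fourier
series is `∑_{k≠0} |k|^r f̂(k) e^{i(kx + (βπ/2) sign k)}`. -/
def WeylNagyClass (r β : ℝ) (f : ℝ → ℝ) : Prop :=
  (∀ t, f (t + 2 * π) = f t) ∧ IntervalIntegrable f volume (-π) π ∧
  ∃ g : ℝ → ℝ, (∀ t, g (t + 2 * π) = g t) ∧ IntervalIntegrable g volume (-π) π ∧
    (∀ᵐ t : ℝ, |g t| ≤ 1) ∧
    fourierCoef (fun t => (g t : ℂ)) 0 = 0 ∧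
    ∀ k : ℤ, k ≠ 0 →
      fourierCoef (fun t => (g t : ℂ)) k
        = ((k.natAbs : ℝ) ^ r : ℝ) * fourierCoef (fun t => (f t : ℂ)) k *
            Complex.exp (Complex.I * (β * π / 2) * (k.sign : ℤ))

/-- The best orthogonal trigonometric approximation of width `m` of the class
`W^r_{β,∞}` in the metric of `L_s`. -/
noncomputable def eBotWeylNagy (r β : ℝ) (m : ℕ) (s : ℝ≥0∞) : ℝ≥0∞ :=
  ⨆ f : {f : ℝ → ℝ // WeylNagyClass r β f},
    ⨅ γ : {γ : Finset ℤ // γ.card = m},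
      eLpNorm
        (fun t : ℝ => (f.1 t : ℂ) -
          ∑ k ∈ γ.1, fourierCoef (fun t => (f.1 t : ℂ)) k * Complex.exp (Complex.I * k * t))
        s (volume.restrict (Set.Ioc (0 : ℝ) (2 * π)))

/-- The trigonometric polynomial with spectrum in `S` and coefficients `c`. -/
noncomputable def trigPoly (S : Finset ℤ) (c : ℤ → ℂ) (t : ℝ) : ℂ :=
  ∑ k ∈ S, c k * Complex.exp (Complex.I * k * t)

lemma continuous_trigPoly (S : Finset ℤ) (c : ℤ → ℂ) : Continuous (trigPoly S c) := by
  unfold trigPoly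
  fun_prop

lemma trigPoly_add_two_pi (S : Finset ℤ) (c : ℤ → ℂ) (t : ℝ) :
    trigPoly S c (t + 2 * π) = trigPoly S c t := by
  unfold trigPoly
  refine Finset.sum_congr rfl fun k _ => ?_
  congr 1
  rw [Complex.exp_eq_exp_iff_exists_int]
  refine ⟨k, ?_⟩
  push_cast
  ring

lemma integral_exp_int_mul (a : ℝ) (m : ℤ) :
    ∫ t in a..(a + 2 * π), Complex.exp (Complex.I * m * t) = if m = 0 then 2 * (π : ℂ) else 0 := by
  split_ifs with h
  · subst h
    simp
  · have hm : Complex.I * (m : ℂ) ≠ 0 := by simp [h]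
    rw [integral_exp_mul_complex hm]
    have : Complex.exp (Complex.I * m * ((a + 2 * π : ℝ) : ℂ))
        = Complex.exp (Complex.I * m * a) := by
      rw [Complex.exp_eq_exp_iff_exists_int]
      refine ⟨m, ?_⟩
      push_cast
      ring
    rw [this]
    simp

lemma integral_trigPoly_mul_exp (a : ℝ) (S : Finset ℤ) (c : ℤ → ℂ) (l : ℤ) :
    ∫ t in a..(a + 2 * π), trigPoly S c t * Complex.exp (-Complex.I * l * t)
      = 2 * π * if l ∈ S then c l else 0 := by
  have h : ∀ t : ℝ, trigPoly S c t * Complex.exp (-Complex.I * l * t)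
      = ∑ k ∈ S, c k * Complex.exp (Complex.I * ((k - l : ℤ) : ℂ) * t) := by
    intro t
    rw [trigPoly, Finset.sum_mul]
    refine Finset.sum_congr rfl fun k _ => ?_
    rw [mul_assoc, ← Complex.exp_add]
    congr 2
    push_cast
    ring
  simp_rw [h]
  rw [intervalIntegral.integral_finsetSum
    (fun k _ => Continuous.intervalIntegrable (by fun_prop) _ _)]
  simp_rw [intervalIntegral.integral_const_mul, integral_exp_int_mul, sub_eq_zero]
  simp [mul_comm]

lemma fourierCoef_trigPoly (S : Finset ℤ) (c : ℤ → ℂ) (l : ℤ) :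
    fourierCoef (trigPoly S c) l = if l ∈ S then c l else 0 := by
  have h := integral_trigPoly_mul_exp (-π) S c l
  rw [show -π + 2 * π = π by ring] at h
  rw [fourierCoef, h]
  have : (π : ℂ) ≠ 0 := by exact_mod_cast Real.pi_ne_zero
  field_simp

lemma trigPoly_sub_orthogonal_sum (S γ : Finset ℤ) (c : ℤ → ℂ) (t : ℝ) :
    trigPoly S c t
        - ∑ k ∈ γ, fourierCoef (trigPoly S c) k * Complex.exp (Complex.I * k * t)
      = trigPoly (S \ γ) c t := by
  simp_rw [fourierCoef_trigPoly, ite_mul, zero_mul]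
  rw [← Finset.sum_filter, Finset.filter_mem_eq_inter, sub_eq_iff_eq_add, trigPoly, trigPoly,
    Finset.inter_comm, add_comm]
  exact (Finset.sum_inter_add_sum_sdiff S γ _).symm

/-- Pairing of trigonometric polynomials over a period. -/
lemma integral_trigPoly_mul_conj (S' S : Finset ℤ) (hS : S' ⊆ S) (c d : ℤ → ℂ) :
    ∫ t in (0 : ℝ)..(2 * π), trigPoly S' c t * (starRingEnd ℂ) (trigPoly S d t)
      = 2 * π * ∑ k ∈ S', c k * (starRingEnd ℂ) (d k) := by
  have h : ∀ t : ℝ, trigPoly S' c t * (starRingEnd ℂ) (trigPoly S d t)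
      = ∑ k ∈ S, (starRingEnd ℂ) (d k) *
          (trigPoly S' c t * Complex.exp (-Complex.I * k * t)) := by
    intro t
    rw [trigPoly, trigPoly, map_sum, Finset.mul_sum]
    refine Finset.sum_congr rfl fun k _ => ?_
    rw [map_mul, ← Complex.exp_conj]
    simp only [map_mul, Complex.conj_I, Complex.conj_ofReal, map_intCast]
    ring
  simp_rw [h]
  rw [intervalIntegral.integral_finsetSum (fun k _ => Continuous.intervalIntegrable
    (by have := continuous_trigPoly S' c; fun_prop) _ _)]
  have h2 := fun l => integral_trigPoly_mul_exp 0 S' c l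
  simp only [zero_add] at h2
  simp_rw [intervalIntegral.integral_const_mul, h2]
  rw [Finset.mul_sum, ← Finset.sum_subset hS]
  · refine Finset.sum_congr rfl fun k hk => ?_
    rw [if_pos hk]
    ring
  · intro k _ hk
    simp [hk]

lemma exists_rudinShapiro (m : ℕ) :
    ∃ a b : ℕ → ℂ, (∀ j, ‖a j‖ = 1) ∧ (∀ j, ‖b j‖ = 1) ∧ ∀ z : ℂ, ‖z‖ = 1 →
      ‖∑ j ∈ range (2 ^ m), a j * z ^ j‖ ^ 2 + ‖∑ j ∈ range (2 ^ m), b j * z ^ j‖ ^ 2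
        = 2 ^ (m + 1) := by
  induction m with
  | zero =>
    refine ⟨fun _ => 1, fun _ => 1, by simp, by simp, fun z _ => ?_⟩
    norm_num
  | succ m ih =>
    obtain ⟨a, b, ha, hb, h⟩ := ih
    have key : ∀ (u : ℂ) (z : ℂ), ∑ j ∈ range (2 ^ (m + 1)),
        (if j < 2 ^ m then a j else u * b (j - 2 ^ m)) * z ^ j
        = ∑ j ∈ range (2 ^ m), a j * z ^ j
          + u * z ^ (2 ^ m) * ∑ j ∈ range (2 ^ m), b j * z ^ j := by
      intro u z
      rw [pow_succ, mul_two, Finset.sum_range_add, Finset.mul_sum]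
      congr 1
      · refine Finset.sum_congr rfl fun j hj => ?_
        rw [if_pos (Finset.mem_range.mp hj)]
      · refine Finset.sum_congr rfl fun j _ => ?_
        rw [if_neg (by omega), Nat.add_sub_cancel_left, pow_add]
        ring
    refine ⟨fun j => if j < 2 ^ m then a j else 1 * b (j - 2 ^ m),
      fun j => if j < 2 ^ m then a j else (-1) * b (j - 2 ^ m), fun j => ?_, fun j => ?_,
      fun z hz => ?_⟩
    · dsimp only
      split_ifs <;> simp [ha, hb]
    · dsimp only
      split_ifs <;> simp [ha, hb]
    · rw [key, key]
      set P := ∑ j ∈ range (2 ^ m), a j * z ^ j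
      set Q := ∑ j ∈ range (2 ^ m), b j * z ^ j
      have hQ : ‖z ^ (2 ^ m) * Q‖ = ‖Q‖ := by simp [hz]
      have hpar := parallelogram_law_with_norm ℝ P (z ^ (2 ^ m) * Q)
      rw [hQ] at hpar
      have h1 := h z hz
      rw [one_mul, neg_one_mul, neg_mul, ← sub_eq_add_neg, pow_succ 2 (m + 1), ← h1]
      linarith

/-- The conjugate symmetric sequence with `c k = d (k - 1)` for `k > 0` and `c 0 = 0`. -/
noncomputable def hermitianExtension (d : ℕ → ℂ) (k : ℤ) : ℂ :=
  if 0 < k then d (k.natAbs - 1)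
  else if k < 0 then (starRingEnd ℂ) (d (k.natAbs - 1)) else 0

lemma hermitianExtension_of_pos (d : ℕ → ℂ) {k : ℤ} (hk : 0 < k) :
    hermitianExtension d k = d (k.natAbs - 1) := if_pos hk

lemma hermitianExtension_of_neg (d : ℕ → ℂ) {k : ℤ} (hk : k < 0) :
    hermitianExtension d k = (starRingEnd ℂ) (d (k.natAbs - 1)) := by
  rw [hermitianExtension, if_neg hk.not_gt, if_pos hk]

lemma hermitianExtension_zero (d : ℕ → ℂ) : hermitianExtension d 0 = 0 := by
  simp [hermitianExtension]

lemma hermitianExtension_mul_conj (c d : ℕ → ℂ) (ρ : ℕ → ℝ)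
    (h : ∀ j, c j * (starRingEnd ℂ) (d j) = ρ j) {k : ℤ} (hk : k ≠ 0) :
    hermitianExtension c k * (starRingEnd ℂ) (hermitianExtension d k) = ρ (k.natAbs - 1) := by
  rcases lt_or_gt_of_ne hk with hk | hk
  · rw [hermitianExtension_of_neg _ hk, hermitianExtension_of_neg _ hk, ← map_mul, h,
      Complex.conj_ofReal]
  · rw [hermitianExtension_of_pos _ hk, hermitianExtension_of_pos _ hk, h]

lemma sum_Icc_neg_eq (F : ℤ → ℂ) (N : ℕ) :
    ∑ k ∈ Icc (-(N : ℤ)) N, F k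
      = F 0 + ∑ j ∈ range N, (F ((j : ℤ) + 1) + F (-((j : ℤ) + 1))) := by
  induction N with
  | zero => simp
  | succ N ih =>
    have hI : Icc (-((N + 1 : ℕ) : ℤ)) ((N + 1 : ℕ) : ℤ)
        = insert ((N : ℤ) + 1) (insert (-((N : ℤ) + 1)) (Icc (-(N : ℤ)) N)) := by
      ext k
      simp only [Finset.mem_Icc, Finset.mem_insert]
      omega
    rw [hI, Finset.sum_insert (by simp only [Finset.mem_Icc, Finset.mem_insert]; omega),
      Finset.sum_insert (by simp only [Finset.mem_Icc]; omega), ih, Finset.sum_range_succ]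
    ring

lemma trigPoly_hermitianExtension (d : ℕ → ℂ) (N : ℕ) (t : ℝ) :
    trigPoly (Icc (-(N : ℤ)) N) (hermitianExtension d) t
      = ((2 * (Complex.exp (Complex.I * t) *
          ∑ j ∈ range N, d j * Complex.exp (Complex.I * t) ^ j).re : ℝ) : ℂ) := by
  rw [trigPoly, sum_Icc_neg_eq, hermitianExtension_zero, zero_mul, zero_add, ← Complex.add_conj,
    Finset.mul_sum, map_sum, ← Finset.sum_add_distrib]
  refine Finset.sum_congr rfl fun j _ => ?_
  have e1 : hermitianExtension d ((j : ℤ) + 1) = d j := by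
    rw [hermitianExtension_of_pos _ (by omega)]
    congr 1
  have e2 : hermitianExtension d (-((j : ℤ) + 1)) = (starRingEnd ℂ) (d j) := by
    rw [hermitianExtension_of_neg _ (by omega)]
    congr 2
  have e3 : Complex.exp (Complex.I * t) * (d j * Complex.exp (Complex.I * t) ^ j)
      = d j * Complex.exp (Complex.I * (((j : ℤ) + 1 : ℤ) : ℂ) * t) := by
    rw [← Complex.exp_nat_mul, mul_left_comm, ← Complex.exp_add]
    congr 2
    push_cast
    ring
  rw [e1, e2, e3, map_mul, ← Complex.exp_conj]
  congr 3
  simp only [map_mul, Complex.conj_I, Complex.conj_ofReal, map_intCast]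
  push_cast
  ring

lemma norm_trigPoly_hermitianExtension_le (d : ℕ → ℂ) (N : ℕ) (M : ℝ)
    (hM : ∀ z : ℂ, ‖z‖ = 1 → ‖∑ j ∈ range N, d j * z ^ j‖ ≤ M) (t : ℝ) :
    ‖trigPoly (Icc (-(N : ℤ)) N) (hermitianExtension d) t‖ ≤ 2 * M := by
  have hz : ‖Complex.exp (Complex.I * t)‖ = 1 := by
    rw [mul_comm]
    exact Complex.norm_exp_ofReal_mul_I t
  rw [trigPoly_hermitianExtension, Complex.norm_real, Real.norm_eq_abs, abs_mul, abs_two]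
  gcongr
  refine (Complex.abs_re_le_norm _).trans ?_
  rw [norm_mul, hz, one_mul]
  exact hM _ hz

lemma ofReal_re_trigPoly_hermitianExtension (d : ℕ → ℂ) (N : ℕ) :
    (fun t => ((trigPoly (Icc (-(N : ℤ)) N) (hermitianExtension d) t).re : ℂ))
      = trigPoly (Icc (-(N : ℤ)) N) (hermitianExtension d) := by
  funext t
  rw [trigPoly_hermitianExtension, Complex.ofReal_re]

/-- A conjugate symmetric polynomial lies in the Weyl–Nagy class once its derivative is bounded. -/
lemma weylNagyClass_re_trigPoly (r β : ℝ) (N : ℕ) (d : ℕ → ℂ)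
    (hd : ∀ z : ℂ, ‖z‖ = 1 → ‖∑ j ∈ range N, d j * z ^ j‖ ≤ 1 / 2) :
    WeylNagyClass r β (fun t => (trigPoly (Icc (-(N : ℤ)) N) (hermitianExtension fun j =>
      (((j + 1 : ℕ) : ℝ) ^ (-r) : ℝ) * Complex.exp (-(Complex.I * (β * π / 2))) * d j) t).re) := by
  set c : ℕ → ℂ := fun j =>
    (((j + 1 : ℕ) : ℝ) ^ (-r) : ℝ) * Complex.exp (-(Complex.I * (β * π / 2))) * d j with hc
  refine ⟨fun t => by simp only [trigPoly_add_two_pi], Continuous.intervalIntegrable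
      (Complex.continuous_re.comp (continuous_trigPoly _ _)) _ _,
    fun t => (trigPoly (Icc (-(N : ℤ)) N) (hermitianExtension d) t).re,
    fun t => by simp only [trigPoly_add_two_pi], Continuous.intervalIntegrable
      (Complex.continuous_re.comp (continuous_trigPoly _ _)) _ _,
    Filter.Eventually.of_forall fun t => ?_, ?_, fun k hk => ?_⟩
  · refine (Complex.abs_re_le_norm _).trans ?_
    simpa using norm_trigPoly_hermitianExtension_le d N (1 / 2) hd t
  · rw [ofReal_re_trigPoly_hermitianExtension, fourierCoef_trigPoly]
    simp [hermitianExtension_zero]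
  · rw [ofReal_re_trigPoly_hermitianExtension, ofReal_re_trigPoly_hermitianExtension,
      fourierCoef_trigPoly, fourierCoef_trigPoly]
    split_ifs with hkS
    swap
    · simp
    have hn : 0 < k.natAbs := Int.natAbs_pos.mpr hk
    have hp : (((k.natAbs : ℝ) ^ r : ℝ) : ℂ) * (((k.natAbs : ℝ) ^ (-r) : ℝ) : ℂ) = 1 := by
      rw [← Complex.ofReal_mul, ← Real.rpow_add (by exact_mod_cast hn)]
      simp
    have hcj : c (k.natAbs - 1) = (((k.natAbs : ℝ) ^ (-r) : ℝ) : ℂ)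
        * Complex.exp (-(Complex.I * (β * π / 2))) * d (k.natAbs - 1) := by
      simp only [hc]
      rw [Nat.sub_add_cancel hn]
    have hexp : Complex.exp (-(Complex.I * (β * π / 2))) * Complex.exp (Complex.I * (β * π / 2))
        = 1 := by
      rw [← Complex.exp_add]
      simp
    rcases lt_or_gt_of_ne hk with h | h
    · have hconj : (starRingEnd ℂ) (Complex.exp (-(Complex.I * (β * π / 2))))
          = Complex.exp (Complex.I * (β * π / 2)) := by
        rw [← Complex.exp_conj]
        congr 1
        simp only [map_neg, map_mul, map_div₀, Complex.conj_I, Complex.conj_ofReal,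
          Complex.conj_ofNat]
        ring
      rw [hermitianExtension_of_neg _ h, hermitianExtension_of_neg _ h, hcj,
        Int.sign_eq_neg_one_of_neg h, map_mul, map_mul, Complex.conj_ofReal, hconj]
      push_cast
      rw [mul_neg_one]
      linear_combination (-(starRingEnd ℂ) (d (k.natAbs - 1))) * hp
        - (starRingEnd ℂ) (d (k.natAbs - 1)) * (((k.natAbs : ℝ) ^ r : ℝ) : ℂ)
          * (((k.natAbs : ℝ) ^ (-r) : ℝ) : ℂ) * hexp
    · rw [hermitianExtension_of_pos _ h, hermitianExtension_of_pos _ h, hcj,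
        Int.sign_eq_one_of_pos h]
      push_cast
      rw [mul_one]
      linear_combination (-d (k.natAbs - 1)) * hp
        - d (k.natAbs - 1) * (((k.natAbs : ℝ) ^ r : ℝ) : ℂ)
          * (((k.natAbs : ℝ) ^ (-r) : ℝ) : ℂ) * hexp

/-- Duality bound for the `L_s` norm over a period against a bounded function. -/
lemma ofReal_div_le_eLpNorm (s : ℝ≥0∞) (hs : 1 ≤ s) (h T : ℝ → ℂ) (hh : Continuous h)
    (B : ℝ) (hB : 0 < B) (hTB : ∀ t, ‖T t‖ ≤ B) :
    ENNReal.ofReal (‖∫ t in (0 : ℝ)..(2 * π), h t * T t‖ / (B * (2 * π)))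
      ≤ eLpNorm h s (volume.restrict (Set.Ioc (0 : ℝ) (2 * π))) := by
  have hpi := Real.pi_pos
  set μ := volume.restrict (Set.Ioc (0 : ℝ) (2 * π)) with hμ
  have hint : Integrable h μ := hh.integrableOn_Ioc
  have huniv : μ Set.univ = ENNReal.ofReal (2 * π) := by simp [hμ]
  have h1 : ‖∫ t in (0 : ℝ)..(2 * π), h t * T t‖ ≤ (∫ t, ‖h t‖ ∂μ) * B := by
    rw [intervalIntegral.integral_of_le (by positivity), ← integral_mul_const]
    refine norm_integral_le_of_norm_le (hint.norm.mul_const B) (Filter.Eventually.of_forall ?_)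
    intro t
    rw [norm_mul]
    exact mul_le_mul_of_nonneg_left (hTB t) (norm_nonneg _)
  have h2 : ENNReal.ofReal (∫ t, ‖h t‖ ∂μ) = eLpNorm h 1 μ := by
    rw [ofReal_integral_norm_eq_lintegral_enorm hint, eLpNorm_one_eq_lintegral_enorm]
  have h3 : eLpNorm h 1 μ ≤ eLpNorm h s μ * ENNReal.ofReal (2 * π) := by
    refine (eLpNorm_le_eLpNorm_mul_rpow_measure_univ hs hh.aestronglyMeasurable).trans ?_
    gcongr
    rw [huniv]
    conv_rhs => rw [← ENNReal.rpow_one (ENNReal.ofReal (2 * π))]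
    refine ENNReal.rpow_le_rpow_of_exponent_le ?_ ?_
    · rw [ENNReal.one_le_ofReal]
      linarith [Real.pi_gt_three]
    · have : 0 ≤ 1 / s.toReal := by positivity
      simp only [ENNReal.toReal_one]
      linarith
  have h4 : ‖∫ t in (0 : ℝ)..(2 * π), h t * T t‖ / (B * (2 * π))
      ≤ (∫ t, ‖h t‖ ∂μ) / (2 * π) := by
    rw [div_le_div_iff₀ (by positivity) (by positivity)]
    nlinarith
  refine (ENNReal.ofReal_le_ofReal h4).trans ?_
  rw [ENNReal.ofReal_div_of_pos (by positivity), h2]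
  exact ENNReal.div_le_of_le_mul h3

lemma exists_two_pow_between (n : ℕ) (hn : 1 ≤ n) : ∃ m : ℕ, 2 * n ≤ 2 ^ m ∧ 2 ^ m ≤ 4 * n := by
  refine ⟨Nat.log 2 n + 2, ?_, ?_⟩
  · have := Nat.lt_pow_succ_log_self (b := 2) (by norm_num) n
    rw [Nat.succ_eq_add_one] at this
    rw [show Nat.log 2 n + 2 = (Nat.log 2 n + 1) + 1 by ring, pow_succ]
    omega
  · have := Nat.pow_log_le_self 2 (x := n) (by omega)
    rw [pow_add]
    omega

/-- Lower estimate for the best orthogonal trigonometric approximation of the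
Weyl–Nagy class: `e^⊥_{2n}(W^r_{β,∞})_s ≥ C n^{-r}` for `1 ≤ s < ∞`. -/
theorem eBot_weylNagy_lower (r β : ℝ) (hr : 0 < r) (s : ℝ≥0∞) (hs1 : 1 ≤ s) (hs2 : s ≠ ⊤) :
    ∃ C : ℝ, 0 < C ∧ ∀ n : ℕ, 1 ≤ n →
      ENNReal.ofReal (C * (n : ℝ) ^ (-r)) ≤ eBotWeylNagy r β (2 * n) s := by
  refine ⟨4 ^ (-r) / 8, by positivity, fun n hn => ?_⟩
  have hpi := Real.pi_pos
  obtain ⟨m, hm1, hm2⟩ := exists_two_pow_between n hn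
  obtain ⟨a, b, ha, -, hab⟩ := exists_rudinShapiro m
  set N : ℕ := 2 ^ m with hN
  have hNpos : (0 : ℝ) < N := by rw [hN]; positivity
  set M : ℝ := √(2 * N)
  have hMpos : 0 < M := Real.sqrt_pos.mpr (by positivity)
  have hMsq : M ^ 2 = 2 * N := Real.sq_sqrt (by positivity)
  have haM : ∀ z : ℂ, ‖z‖ = 1 → ‖∑ j ∈ range N, a j * z ^ j‖ ≤ M := by
    intro z hz
    refine Real.le_sqrt_of_sq_le ?_
    have h1 := hab z hz
    have h2 : (2 : ℝ) ^ (m + 1) = 2 * N := by rw [hN]; push_cast; ring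
    rw [h2] at h1
    nlinarith [sq_nonneg ‖∑ j ∈ range N, b j * z ^ j‖]
  set w : ℂ := Complex.exp (-(Complex.I * (β * π / 2))) with hw
  have hwn : ‖w‖ = 1 := by
    rw [hw, show -(Complex.I * ((β : ℂ) * π / 2)) = ((-(β * π / 2) : ℝ) : ℂ) * Complex.I by
      push_cast; ring]
    exact Complex.norm_exp_ofReal_mul_I _
  set d : ℕ → ℂ := fun j => (1 / (2 * M) : ℝ) * a j with hd
  set c : ℕ → ℂ := fun j => (((j + 1 : ℕ) : ℝ) ^ (-r) : ℝ) * w * d j with hc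
  set S : Finset ℤ := Icc (-(N : ℤ)) N with hS
  have hmem : WeylNagyClass r β (fun t => (trigPoly S (hermitianExtension c) t).re) := by
    refine weylNagyClass_re_trigPoly r β N d fun z hz => ?_
    simp only [hd, mul_assoc]
    rw [← Finset.mul_sum, norm_mul, Complex.norm_real, Real.norm_of_nonneg (by positivity),
      one_div_mul_eq_div, div_le_div_iff₀ (by positivity) (by positivity)]
    linarith [haM z hz]
  refine le_trans ?_ (le_iSup _ ⟨_, hmem⟩)
  refine le_iInf fun γ => ?_
  obtain ⟨γ, hγ⟩ := γ
  have hre : (fun t => ((trigPoly S (hermitianExtension c) t).re : ℂ))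
      = trigPoly S (hermitianExtension c) := ofReal_re_trigPoly_hermitianExtension c N
  have hdiff : (fun t : ℝ => ((trigPoly S (hermitianExtension c) t).re : ℂ) - ∑ k ∈ γ,
      fourierCoef (fun t => ((trigPoly S (hermitianExtension c) t).re : ℂ)) k
        * Complex.exp (Complex.I * k * t)) = trigPoly (S \ γ) (hermitianExtension c) := by
    funext t
    rw [hre, congrFun hre t, trigPoly_sub_orthogonal_sum]
  dsimp only
  rw [hdiff]
  set T : ℝ → ℂ := trigPoly S (hermitianExtension fun j => w * a j) with hT
  have hTB : ∀ t, ‖(starRingEnd ℂ) (T t)‖ ≤ 2 * M := by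
    intro t
    rw [RCLike.norm_conj]
    refine norm_trigPoly_hermitianExtension_le _ N M (fun z hz => ?_) t
    simp only [mul_assoc]
    rw [← Finset.mul_sum, norm_mul, hwn, one_mul]
    exact haM z hz
  refine le_trans (ENNReal.ofReal_le_ofReal ?_)
    (ofReal_div_le_eLpNorm s hs1 _ (fun t => (starRingEnd ℂ) (T t))
      (continuous_trigPoly _ _) (2 * M) (by positivity) hTB)
  rw [integral_trigPoly_mul_conj _ _ Finset.sdiff_subset]
  set ρ : ℕ → ℝ := fun j => ((j + 1 : ℕ) : ℝ) ^ (-r) * (1 / (2 * M)) with hρ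
  have hcd : ∀ j, c j * (starRingEnd ℂ) (w * a j) = ρ j := by
    intro j
    have h1 : w * (starRingEnd ℂ) w = 1 := by
      simp [Complex.mul_conj, Complex.normSq_eq_norm_sq, hwn]
    have h2 : a j * (starRingEnd ℂ) (a j) = 1 := by
      simp [Complex.mul_conj, Complex.normSq_eq_norm_sq, ha]
    simp only [hc, hd, hρ, map_mul]
    rw [Complex.ofReal_mul]
    linear_combination ((((j + 1 : ℕ) : ℝ) ^ (-r) : ℝ) : ℂ) * ((1 / (2 * M) : ℝ) : ℂ)
      * (a j * (starRingEnd ℂ) (a j) * h1 + h2)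
  have hsum : ∑ k ∈ S \ γ, hermitianExtension c k
        * (starRingEnd ℂ) (hermitianExtension (fun j => w * a j) k)
      = ((∑ k ∈ (S \ γ).erase 0, ρ (k.natAbs - 1) : ℝ) : ℂ) := by
    rw [← Finset.sum_erase (a := 0) _ (by rw [hermitianExtension_zero, zero_mul]),
      Complex.ofReal_sum]
    exact Finset.sum_congr rfl fun k hk =>
      hermitianExtension_mul_conj _ _ ρ hcd (Finset.ne_of_mem_erase hk)
  have hcard : N ≤ ((S \ γ).erase 0).card := by
    have h1 : S.card = 2 * N + 1 := by
      rw [hS, Int.card_Icc]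
      omega
    have h2 := Finset.le_card_sdiff γ S
    have h3 := Finset.pred_card_le_card_erase (s := S \ γ) (a := 0)
    omega
  have hlow : (N : ℝ) * ((N : ℝ) ^ (-r) * (1 / (2 * M)))
      ≤ ∑ k ∈ (S \ γ).erase 0, ρ (k.natAbs - 1) := by
    have h1 : ∀ k ∈ (S \ γ).erase 0, (N : ℝ) ^ (-r) * (1 / (2 * M)) ≤ ρ (k.natAbs - 1) := by
      intro k hk
      simp only [Finset.mem_erase, Finset.mem_sdiff, hS, Finset.mem_Icc] at hk
      simp only [hρ]
      refine mul_le_mul_of_nonneg_right ?_ (by positivity)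
      refine Real.rpow_le_rpow_of_nonpos (by positivity) ?_ (by linarith)
      have : k.natAbs - 1 + 1 ≤ N := by omega
      exact_mod_cast this
    have h2 := Finset.card_nsmul_le_sum _ _ _ h1
    rw [nsmul_eq_mul] at h2
    refine le_trans ?_ h2
    gcongr
  rw [hsum, norm_mul, Complex.norm_real, Real.norm_of_nonneg (le_trans (by positivity) hlow)]
  have hnorm : ‖2 * (π : ℂ)‖ = 2 * π := by
    rw [norm_mul, Complex.norm_real, Real.norm_of_nonneg hpi.le, Complex.norm_ofNat]
  have hn4 : (4 : ℝ) ^ (-r) * (n : ℝ) ^ (-r) ≤ (N : ℝ) ^ (-r) := by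
    rw [← Real.mul_rpow (by positivity) (by positivity)]
    refine Real.rpow_le_rpow_of_nonpos hNpos ?_ (by linarith)
    exact_mod_cast hm2
  have hfin : (N : ℝ) * ((N : ℝ) ^ (-r) * (1 / (2 * M))) = (N : ℝ) ^ (-r) / 8 * (2 * M) := by
    field_simp
    rw [hMsq]
    ring
  rw [hnorm, mul_comm (2 * M), mul_div_mul_left _ _ (by positivity), le_div_iff₀ (by positivity)]
  refine le_trans ?_ hlow
  rw [hfin]
  refine mul_le_mul_of_nonneg_right ?_ (by positivity)
  linarith
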